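/- arXiv:0708.2278 — 3 statements merged into one kernel-verified Lean document; each statement's English description precedes it below -/
import Mathlib

section
/- Let n be a natural number, b : Fin (n+1) → ℤ, and z, w : Fin (n+1) → ℂ. The stabilizer subgroup {t ∈ S¹ : t^{b i}·z i = z i and t^{−b i}·w i = w i for all i} of the point (z, w) in the circle group is finite if and only if there exists an index i with b i ≠ 0 and (z i ≠ 0 or w i ≠ 0). -/
theorem Circle.infinite_univ : (Set.univ : Set Circle).Infinite := by
  have : Infinite (Set.Ioc (-Real.pi) Real.pi) :=
    (Set.Ioc_infinite (by linarith [Real.pi_pos])).to_subtype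
  have : Infinite Circle := Infinite.of_injective _ Circle.argEquiv.symm.injective
  exact Set.infinite_univ

theorem Circle.finite_setOf_zpow_eq_one {k : ℤ} (hk : k ≠ 0) :
    {t : Circle | (t : ℂ) ^ k = 1}.Finite := by
  have hpos : 0 < k.natAbs := Int.natAbs_pos.mpr hk
  refine Set.Finite.subset (Set.Finite.preimage (f := fun t : Circle => (t : ℂ))
    Circle.coe_injective.injOn
    (Polynomial.nthRootsFinset k.natAbs (1 : ℂ)).finite_toSet) fun (t : Circle) ht => ?_
  rw [Set.mem_preimage, Finset.mem_coe, Polynomial.mem_nthRootsFinset hpos]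
  have h : t ^ k = 1 := by
    rw [← Circle.coe_eq_one, Circle.coe_zpow]
    exact ht
  rw [← Circle.coe_pow, pow_natAbs_eq_one.mpr h, Circle.coe_one]

theorem stabilizer_finite_iff (n : ℕ) (b : Fin (n + 1) → ℤ)
    (z w : Fin (n + 1) → ℂ) :
    ({t : Circle | ∀ i, (t : ℂ) ^ (b i) * z i = z i ∧
        (t : ℂ) ^ (-(b i)) * w i = w i}).Finite ↔
      ∃ i, b i ≠ 0 ∧ (z i ≠ 0 ∨ w i ≠ 0) := by
  constructor
  · intro hfin
    by_contra! h
    refine Circle.infinite_univ (hfin.subset fun t _ i => ?_)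
    by_cases hb : b i = 0
    · simp [hb]
    · simp [h i hb]
  · rintro ⟨i, hb, hz | hw⟩
    · exact (Circle.finite_setOf_zpow_eq_one hb).subset fun t ht =>
        (mul_eq_right₀ hz).mp (ht i).1
    · exact (Circle.finite_setOf_zpow_eq_one (neg_ne_zero.mpr hb)).subset fun t ht =>
        (mul_eq_right₀ hw).mp (ht i).2
end

section
/- Let n be a natural number and b_0, …, b_n positive integers, and let S¹ act on ℂ^{n+1}⊕ℂ^{n+1} by t·(z,w)_i = (t^{b_i}z_i, t^{−b_i}w_i). Then the subgroup of S¹ generated by the union of the stabilizers of all points whose stabilizer is finite equals the group of ℓ-th roots of unity, where ℓ = lcm(b_0, …, b_n). -/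
/-- A subgroup containing all `b i`-torsion elements for `i ∈ s` contains all elements whose order
divides the least common multiple of the `b i`. -/
theorem Subgroup.mem_of_pow_finset_lcm_eq_one {G ι : Type*} [Group G] (H : Subgroup G)
    (s : Finset ι) (b : ι → ℕ) (h : ∀ i ∈ s, ∀ t : G, t ^ b i = 1 → t ∈ H) (t : G)
    (ht : t ^ s.lcm b = 1) : t ∈ H := by
  classical
  induction s using Finset.induction_on generalizing t with
  | empty =>
    have h1 : t = 1 := by simpa using ht
    exact h1 ▸ H.one_mem
  | insert i s _ ih =>
    rw [Finset.lcm_insert] at ht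
    have hs := ih fun j hj => h j (Finset.mem_insert_of_mem hj)
    have hi := h i (Finset.mem_insert_self i s)
    generalize s.lcm b = c at ht hs
    generalize b i = a at ht hi
    obtain ⟨a', c', hco, ha, hc⟩ := Nat.exists_coprime a c
    rcases Nat.eq_zero_or_pos (a.gcd c) with hg | hg
    · refine hi t ?_
      rw [Nat.eq_zero_of_gcd_eq_zero_left hg, pow_zero]
    have hmul : a.gcd c * lcm a c = a * c := Nat.gcd_mul_lcm a c
    generalize a.gcd c = g at ha hc hg hmul
    have hlcm : lcm a c = g * a' * c' := by
      refine Nat.eq_of_mul_eq_mul_left hg (hmul.trans ?_)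
      rw [ha, hc]
      ring
    have hu : t ^ c' ∈ H := hi _ <| by
      rw [← pow_mul, ← ht, hlcm]
      congr 1
      rw [ha]
      ring
    have hv : t ^ a' ∈ H := hs _ <| by
      rw [← pow_mul, ← ht, hlcm]
      congr 1
      rw [hc]
      ring
    have hbez : t = (t ^ a') ^ a'.gcdA c' * (t ^ c') ^ a'.gcdB c' := by
      have hone := Nat.gcd_eq_gcd_ab a' c'
      rw [hco.gcd_eq_one, Nat.cast_one] at hone
      rw [← zpow_natCast, ← zpow_natCast, ← zpow_mul, ← zpow_mul, ← zpow_add, ← hone, zpow_one]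
    rw [hbez]
    exact H.mul_mem (H.zpow_mem hv _) (H.zpow_mem hu _)

theorem Circle.infinite : Infinite Circle :=
  have : Infinite (Set.Ioc (-Real.pi) Real.pi) :=
    (Set.Ioc_infinite (by linarith [Real.pi_pos])).to_subtype
  Infinite.of_injective _ Circle.argEquiv.symm.injective

theorem Circle.finite_setOf_pow_eq_one {m : ℕ} (hm : 0 < m) :
    {t : Circle | (t : ℂ) ^ m = 1}.Finite := by
  refine Set.Finite.preimage (f := ((↑) : Circle → ℂ)) Circle.coe_injective.injOn
    (s := {x : ℂ | x ^ m = 1}) ?_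
  refine (Polynomial.nthRoots m (1 : ℂ)).toFinset.finite_toSet.subset fun x hx => ?_
  simpa [Polynomial.mem_nthRoots hm] using hx

theorem closure_finite_stabilizers_eq_roots_of_unity (n : ℕ)
    (b : Fin (n + 1) → ℕ) (hb : ∀ i, 0 < b i) (ℓ : ℕ)
    (hℓ : ℓ = Finset.univ.lcm b)
    (stab : (Fin (n + 1) → ℂ) → (Fin (n + 1) → ℂ) → Set Circle)
    (hstab : ∀ z w, stab z w =
      {t : Circle | ∀ i, (t : ℂ) ^ (b i : ℤ) * z i = z i ∧
        (t : ℂ) ^ (-(b i : ℤ)) * w i = w i}) :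
    (Subgroup.closure
        (⋃ (z : Fin (n + 1) → ℂ) (w : Fin (n + 1) → ℂ)
          (_ : (stab z w).Finite), stab z w) : Set Circle) =
      {t : Circle | (t : ℂ) ^ ℓ = 1} := by
  have hcoe (t : Circle) (m : ℕ) : (t : ℂ) ^ m = 1 ↔ t ^ m = 1 := by
    rw [← Circle.coe_pow, Circle.coe_eq_one]
  apply Set.Subset.antisymm
  · have hle : Subgroup.closure (⋃ (z : Fin (n + 1) → ℂ) (w : Fin (n + 1) → ℂ)
        (_ : (stab z w).Finite), stab z w) ≤ (powMonoidHom ℓ : Circle →* Circle).ker := by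
      rw [Subgroup.closure_le]
      simp only [Set.iUnion_subset_iff]
      intro z w hfin t ht
      have hne : ∃ i, z i ≠ 0 ∨ w i ≠ 0 := by
        by_contra! hzero
        have := Circle.infinite
        refine Set.infinite_univ (hfin.subset fun u _ => ?_)
        rw [hstab]
        intro i
        simp [hzero i]
      obtain ⟨i, hi⟩ := hne
      rw [hstab] at ht
      have hpow : (t : ℂ) ^ b i = 1 := by
        rcases hi with hz | hw
        · simpa using (mul_eq_right₀ hz).mp (ht i).1
        · simpa using (mul_eq_right₀ hw).mp (ht i).2
      obtain ⟨k, hk⟩ : b i ∣ ℓ := hℓ ▸ Finset.dvd_lcm (Finset.mem_univ i)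
      change t ^ ℓ = 1
      rw [hk, pow_mul, (hcoe t _).mp hpow, one_pow]
    exact fun t ht => (hcoe t ℓ).mpr (hle ht)
  · intro t ht
    refine Subgroup.mem_of_pow_finset_lcm_eq_one _ Finset.univ b (fun i _ u hu => ?_) t
      (hℓ ▸ (hcoe t ℓ).mp ht)
    have hsingle : stab (Pi.single i 1) 0 = {t : Circle | (t : ℂ) ^ b i = 1} := by
      rw [hstab]
      ext v
      refine ⟨fun hv => by simpa using (hv i).1, fun hv j => ?_⟩
      rcases eq_or_ne j i with rfl | hj
      · simpa using hv
      · simp [hj]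
    apply Subgroup.subset_closure
    simp only [Set.mem_iUnion]
    refine ⟨Pi.single i 1, 0, ?_, ?_⟩
    · exact hsingle ▸ Circle.finite_setOf_pow_eq_one (hb i)
    · exact hsingle ▸ (hcoe u _).mpr hu
end

section
/- Let A = ℚ[u,α]/(u³, uα, α² − u²) and B = ℚ[u,γ]/(u³, γ², uγ), quotients of polynomial rings in two variables over ℚ. Then A and B are not isomorphic as ℚ-algebras. -/
/-- A substitution of polynomials without constant and linear term yields polynomials without
linear term. -/
lemma coeff_one_aeval_eq_zero {σ R : Type*} [CommRing R] (f : σ → Polynomial R)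
    (h₀ : ∀ i, (f i).coeff 0 = 0) (h₁ : ∀ i, (f i).coeff 1 = 0) (p : MvPolynomial σ R) :
    (MvPolynomial.aeval f p).coeff 1 = 0 := by
  induction p using MvPolynomial.induction_on with
  | C a => simp
  | add p q hp hq => simp [hp, hq]
  | mul_X p i _ => simp [Polynomial.coeff_mul, Finset.Nat.antidiagonal_succ, h₀, h₁]

/-- If `a ^ 3`, `a * b` and `b ^ 2 - a ^ 2` vanish modulo `X ^ 3`, then `a` and `b` have
neither constant nor linear term. -/
lemma coeff_eq_zero_of_X_pow_three_dvd {K : Type*} [CommRing K] [IsDomain K] {a b : Polynomial K}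
    (h₁ : Polynomial.X ^ 3 ∣ a ^ 3) (h₂ : Polynomial.X ^ 3 ∣ a * b)
    (h₃ : Polynomial.X ^ 3 ∣ b ^ 2 - a ^ 2) :
    (a.coeff 0 = 0 ∧ a.coeff 1 = 0) ∧ (b.coeff 0 = 0 ∧ b.coeff 1 = 0) := by
  rw [Polynomial.X_pow_dvd_iff] at h₁ h₂ h₃
  have ha : a.coeff 0 = 0 := by
    simpa [Polynomial.coeff_zero_eq_eval_zero] using h₁ 0 (by norm_num)
  have hb : b.coeff 0 = 0 := by
    have h := h₃ 0 (by norm_num)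
    rw [Polynomial.coeff_zero_eq_eval_zero] at ha h ⊢
    simpa [ha] using h
  have hab : a.coeff 1 * b.coeff 1 = 0 := by
    simpa [Polynomial.coeff_mul, Finset.Nat.antidiagonal_succ, ha, hb] using h₂ 2 (by norm_num)
  have hsq : b.coeff 1 * b.coeff 1 - a.coeff 1 * a.coeff 1 = 0 := by
    simpa [sq, Polynomial.coeff_mul, Finset.Nat.antidiagonal_succ, ha, hb]
      using h₃ 2 (by norm_num)
  rcases mul_eq_zero.mp hab with h | h <;> simp_all

open MvPolynomial in
/-- A quotient of `K[u, α]` in which `u ^ 3`, `u * α` and `α ^ 2 - u ^ 2` vanish does not surject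
onto `K[t] / (t ^ 3)`. -/
lemma not_surjective_quotient_X_pow_three {K : Type*} [CommRing K] [IsDomain K]
    {I : Ideal (MvPolynomial (Fin 2) K)} (h₁ : X 0 ^ 3 ∈ I) (h₂ : X 0 * X 1 ∈ I)
    (h₃ : X 1 ^ 2 - X 0 ^ 2 ∈ I)
    (φ : (MvPolynomial (Fin 2) K ⧸ I) →ₐ[K]
        (Polynomial K ⧸ Ideal.span {(Polynomial.X : Polynomial K) ^ 3})) :
    ¬ Function.Surjective φ := by
  intro hφ
  choose f hf using fun i => Ideal.Quotient.mk_surjective (φ (Ideal.Quotient.mk I (X i)))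
  have hcomp : φ.comp (Ideal.Quotient.mkₐ K I) = (Ideal.Quotient.mkₐ K _).comp (aeval f) :=
    algHom_ext fun i => by simp [hf]
  have hmk (p : MvPolynomial (Fin 2) K) :
      φ (Ideal.Quotient.mk I p) = Ideal.Quotient.mk _ (aeval f p) := DFunLike.congr_fun hcomp p
  have hdvd {p : MvPolynomial (Fin 2) K} (hp : p ∈ I) : Polynomial.X ^ 3 ∣ aeval f p := by
    rw [← Ideal.mem_span_singleton, ← Ideal.Quotient.eq_zero_iff_mem, ← hmk,
      Ideal.Quotient.eq_zero_iff_mem.mpr hp, map_zero]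
  obtain ⟨⟨ha₀, ha₁⟩, hb₀, hb₁⟩ := coeff_eq_zero_of_X_pow_three_dvd (a := f 0) (b := f 1)
    (by simpa using hdvd h₁) (by simpa using hdvd h₂) (by simpa using hdvd h₃)
  obtain ⟨x, hx⟩ := hφ (Ideal.Quotient.mk _ Polynomial.X)
  obtain ⟨p, rfl⟩ := Ideal.Quotient.mk_surjective x
  rw [hmk, Ideal.Quotient.eq, Ideal.mem_span_singleton, Polynomial.X_pow_dvd_iff] at hx
  have h := hx 1 (by norm_num)
  rw [Polynomial.coeff_sub, coeff_one_aeval_eq_zero f (Fin.forall_fin_two.mpr ⟨ha₀, hb₀⟩)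
    (Fin.forall_fin_two.mpr ⟨ha₁, hb₁⟩)] at h
  simp at h

open MvPolynomial in
/-- The algebra `R[u, γ] / (u ^ 3, γ ^ 2, u * γ)` surjects onto `R[t] / (t ^ 3)`. -/
lemma exists_surjective_quotient_X_pow_three (R : Type*) [CommRing R] :
    ∃ ψ : (MvPolynomial (Fin 2) R ⧸
          Ideal.span {(X 0 : MvPolynomial (Fin 2) R) ^ 3, X 1 ^ 2, X 0 * X 1}) →ₐ[R]
        (Polynomial R ⧸ Ideal.span {(Polynomial.X : Polynomial R) ^ 3}),
      Function.Surjective ψ := by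
  set I := Ideal.span {(X 0 : MvPolynomial (Fin 2) R) ^ 3, X 1 ^ 2, X 0 * X 1}
  set J := Ideal.span {(Polynomial.X : Polynomial R) ^ 3} with hJ
  let g : MvPolynomial (Fin 2) R →ₐ[R] Polynomial R := aeval ![Polynomial.X, 0]
  have hg : Function.Surjective g := fun q =>
    ⟨Polynomial.aeval (X 0) q, by simp [← Polynomial.aeval_algHom_apply, g]⟩
  have hIJ : I ≤ RingHom.ker ((Ideal.Quotient.mkₐ R J).comp g) := by
    rw [Ideal.span_le]
    rintro _ (rfl | rfl | rfl)
    · simp [g, RingHom.mem_ker, ← map_pow, Ideal.Quotient.eq_zero_iff_mem, hJ]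
    · simp [g, RingHom.mem_ker]
    · simp [g, RingHom.mem_ker]
  exact ⟨Ideal.Quotient.liftₐ I ((Ideal.Quotient.mkₐ R J).comp g) hIJ,
    Ideal.Quotient.lift_surjective_of_surjective I hIJ
      ((Ideal.Quotient.mkₐ_surjective R J).comp hg)⟩

open MvPolynomial in
theorem CR_rings_not_isomorphic :
    IsEmpty
      ((MvPolynomial (Fin 2) ℚ ⧸
          Ideal.span {(X 0 : MvPolynomial (Fin 2) ℚ) ^ 3, X 0 * X 1,
            X 1 ^ 2 - X 0 ^ 2}) ≃ₐ[ℚ]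
        (MvPolynomial (Fin 2) ℚ ⧸
          Ideal.span {(X 0 : MvPolynomial (Fin 2) ℚ) ^ 3, X 1 ^ 2,
            X 0 * X 1})) := by
  refine ⟨fun e => ?_⟩
  obtain ⟨ψ, hψ⟩ := exists_surjective_quotient_X_pow_three ℚ
  exact not_surjective_quotient_X_pow_three (Ideal.subset_span (by simp))
    (Ideal.subset_span (by simp)) (Ideal.subset_span (by simp)) (ψ.comp e.toAlgHom)
    (hψ.comp e.surjective)
end
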